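/- Let p ≥ 2 be an integer and let c = (log(p/(p−1))·log 2)/(log(2p/(p−1))·log p). There exist constants b > 0 and N > 0 (depending only on p) such that for every integer n ≥ N there exist real polynomials P and Q, with deg P ≤ n, deg Q ≤ n−1, and Q(x) > 0 for all x ∈ [0,1], such that |P(x)/Q(x) − x^(1/p)| ≤ exp(−b·n^c) for all x ∈ [0,1]. -/

import Mathlib

open Polynomial in
/-- Expanding `1 / (t + x)` around the midpoint of a dyadic block gives a rational approximation
of the corresponding part of the integral representation of `x ^ α`. -/
lemma exists_rational_approx_dyadic_block {α : ℝ} (hα : α ∈ Set.Ioo (0 : ℝ) 1) {a : ℝ} (ha : 0 < a)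
    (m : ℕ) :
    ∃ A B : ℝ[X], A.natDegree ≤ m ∧ B.natDegree ≤ m ∧ (∀ x : ℝ, 0 ≤ x → 0 < B.eval x) ∧
      ∀ x : ℝ, 0 ≤ x →
        |A.eval x / B.eval x - ∫ t in a..2 * a, Real.rpowIntegrand₀₁ α t x| ≤
          (1 / 3) ^ m * ∫ t in a..2 * a, Real.rpowIntegrand₀₁ α t x := by
  set c : ℝ := 3 / 2 * a with hc
  have hc0 : 0 < c := by positivity
  have hle : a ≤ 2 * a := by linarith
  let μ : ℕ → ℝ := fun i => ∫ t in a..2 * a, t ^ (α - 1) * (c - t) ^ i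
  have hpow : ContinuousOn (fun t : ℝ => t ^ (α - 1)) (Set.uIcc a (2 * a)) := by
    rw [Set.uIcc_of_le hle]
    exact ContinuousOn.rpow_const (by fun_prop) fun t ht => .inl (ha.trans_le ht.1).ne'
  refine ⟨∑ i ∈ Finset.range m, C (μ i) * X * (X + C c) ^ (m - 1 - i), (X + C c) ^ m,
    ?_, ?_, ?_, ?_⟩
  · refine natDegree_sum_le_of_forall_le _ _ fun i hi => ?_
    have hi' := Finset.mem_range.1 hi
    have h1 : ((X + C c) ^ (m - 1 - i)).natDegree ≤ m - 1 - i := by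
      simp
    have h2 : (C (μ i) * X).natDegree ≤ 1 :=
      (natDegree_C_mul_le _ _).trans natDegree_X_le
    have := natDegree_mul_le (p := C (μ i) * X) (q := (X + C c) ^ (m - 1 - i))
    omega
  · simp
  · intro x hx
    simp only [eval_pow, eval_add, eval_X, eval_C]
    positivity
  · intro x hx
    have hcx : 0 < c + x := by positivity
    have hcx' : 0 < x + c := by positivity
    have hf : ContinuousOn (fun t => Real.rpowIntegrand₀₁ α t x) (Set.uIcc a (2 * a)) := by
      refine (Real.continuousOn_rpowIntegrand₀₁ hα hx).mono ?_
      rw [Set.uIcc_of_le hle]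
      exact fun t ht => ha.trans_le ht.1
    have hrat : (∑ i ∈ Finset.range m, C (μ i) * X * (X + C c) ^ (m - 1 - i)).eval x /
        ((X + C c) ^ m).eval x =
        ∫ t in a..2 * a, ∑ i ∈ Finset.range m,
          t ^ (α - 1) * (c - t) ^ i * (x / (x + c) ^ (i + 1)) := by
      rw [intervalIntegral.integral_finsetSum]
      · simp only [eval_finsetSum, eval_mul, eval_pow, eval_add, eval_X, eval_C,
          intervalIntegral.integral_mul_const, Finset.sum_div]
        refine Finset.sum_congr rfl fun i hi => ?_
        have hi' := Finset.mem_range.1 hi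
        have : (x + c) ^ m = (x + c) ^ (m - 1 - i) * (x + c) ^ (i + 1) := by
          rw [← pow_add]; congr 1; omega
        rw [this]
        have := (pow_pos hcx' (m - 1 - i)).ne'
        have := (pow_pos hcx' (i + 1)).ne'
        change μ i * x * _ / _ = μ i * _
        field_simp
      · intro i _
        apply ContinuousOn.intervalIntegrable
        fun_prop
    rw [hrat, ← intervalIntegral.integral_sub, ← intervalIntegral.integral_const_mul]
    · rw [← Real.norm_eq_abs]
      refine intervalIntegral.norm_integral_le_of_norm_le hle (.of_forall fun t ht => ?_)
        (ContinuousOn.intervalIntegrable (by fun_prop))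
      have ht0 : 0 < t := ha.trans ht.1
      have htx : 0 < t + x := by positivity
      have hfn := Real.rpowIntegrand₀₁_nonneg hα.1 ht0.le hx
      have hgeom : ∑ i ∈ Finset.range m, t ^ (α - 1) * (c - t) ^ i * (x / (x + c) ^ (i + 1)) =
          Real.rpowIntegrand₀₁ α t x * (1 - ((c - t) / (x + c)) ^ m) := by
        have h1 := mul_neg_geom_sum ((c - t) / (x + c)) m
        have h2 : 1 - (c - t) / (x + c) = (t + x) / (x + c) := by field_simp; ring
        rw [Real.rpowIntegrand₀₁_eq_pow_div hα ht0.le hx, ← h1, h2, Finset.mul_sum,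
          Finset.mul_sum]
        refine Finset.sum_congr rfl fun i _ => ?_
        rw [div_pow, pow_succ]
        have := (pow_pos hcx' i).ne'
        field_simp
      have hr : |(c - t) / (x + c)| ≤ 1 / 3 := by
        rw [abs_div, abs_of_pos hcx', div_le_iff₀ hcx', abs_le]
        constructor <;> linarith [ht.1, ht.2]
      rw [hgeom, Real.norm_eq_abs, mul_one_sub, sub_sub_cancel_left, abs_neg, abs_mul,
        abs_of_nonneg hfn, abs_pow, mul_comm]
      gcongr
    · apply ContinuousOn.intervalIntegrable
      fun_prop
    · exact hf.intervalIntegrable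

open Polynomial in
lemma exists_rational_approx_dyadic_blocks {α : ℝ} (hα : α ∈ Set.Ioo (0 : ℝ) 1) {a : ℝ}
    (ha : 0 < a) (m k : ℕ) :
    ∃ A B : ℝ[X], A.natDegree ≤ k * m ∧ B.natDegree ≤ k * m ∧
      (∀ x : ℝ, 0 ≤ x → 0 < B.eval x) ∧
      ∀ x : ℝ, 0 ≤ x →
        |A.eval x / B.eval x - ∫ t in a..2 ^ k * a, Real.rpowIntegrand₀₁ α t x| ≤
          (1 / 3) ^ m * ∫ t in a..2 ^ k * a, Real.rpowIntegrand₀₁ α t x := by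
  induction k with
  | zero => exact ⟨0, 1, by simp, by simp, by simp, by simp⟩
  | succ k ih =>
    obtain ⟨A, B, hA, hB, hBpos, hAB⟩ := ih
    have hka : 0 < 2 ^ k * a := by positivity
    obtain ⟨A', B', hA', hB', hBpos', hAB'⟩ := exists_rational_approx_dyadic_block hα hka m
    refine ⟨A * B' + A' * B, B * B', ?_, ?_, ?_, ?_⟩
    · refine natDegree_add_le_of_degree_le ?_ ?_
      · have := natDegree_mul_le (p := A) (q := B')
        rw [Nat.succ_mul]; omega
      · have := natDegree_mul_le (p := A') (q := B)
        rw [Nat.succ_mul]; omega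
    · have := natDegree_mul_le (p := B) (q := B')
      rw [Nat.succ_mul]; omega
    · intro x hx
      rw [eval_mul]
      exact mul_pos (hBpos x hx) (hBpos' x hx)
    · intro x hx
      have hint : ∀ u v : ℝ, 0 < u → 0 < v → IntervalIntegrable
          (fun t => Real.rpowIntegrand₀₁ α t x) MeasureTheory.volume u v := by
        intro u v hu hv
        refine ((Real.continuousOn_rpowIntegrand₀₁ hα hx).mono fun t ht => ?_).intervalIntegrable
        exact (lt_min hu hv).trans_le ht.1
      have hsplit : (∫ t in a..2 ^ (k + 1) * a, Real.rpowIntegrand₀₁ α t x) =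
          (∫ t in a..2 ^ k * a, Real.rpowIntegrand₀₁ α t x) +
            ∫ t in 2 ^ k * a..2 * (2 ^ k * a), Real.rpowIntegrand₀₁ α t x := by
        rw [intervalIntegral.integral_add_adjacent_intervals (hint _ _ ha hka)
          (hint _ _ hka (by positivity)), pow_succ']
        congr 1; ring
      have hfrac : (A * B' + A' * B).eval x / (B * B').eval x =
          A.eval x / B.eval x + A'.eval x / B'.eval x := by
        have := (hBpos x hx).ne'
        have := (hBpos' x hx).ne'
        simp only [eval_add, eval_mul]
        field_simp
      rw [hsplit, hfrac, mul_add, add_sub_add_comm]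
      exact (abs_add_le _ _).trans (add_le_add (hAB x hx) (hAB' x hx))

lemma integral_rpowIntegrand_Ioc_zero_le {α : ℝ} (hα : α ∈ Set.Ioo (0 : ℝ) 1) {a x : ℝ}
    (ha : 0 ≤ a) (hx : 0 ≤ x) :
    ∫ t in Set.Ioc 0 a, Real.rpowIntegrand₀₁ α t x ≤ a ^ α / α := by
  have hi : IntervalIntegrable (fun t : ℝ => t ^ (α - 1)) MeasureTheory.volume 0 a :=
    intervalIntegral.intervalIntegrable_rpow' (by linarith [hα.1])
  calc ∫ t in Set.Ioc 0 a, Real.rpowIntegrand₀₁ α t x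
      ≤ ∫ t in Set.Ioc 0 a, t ^ (α - 1) :=
        MeasureTheory.setIntegral_mono_on
          ((Real.integrableOn_rpowIntegrand₀₁_Ioi hα hx).mono_set Set.Ioc_subset_Ioi_self)
          ((intervalIntegrable_iff_integrableOn_Ioc_of_le ha).1 hi) measurableSet_Ioc
          fun t ht => Real.rpowIntegrand₀₁_le_rpow_sub_one hα ht.1.le hx
    _ = a ^ α / α := by
        rw [← intervalIntegral.integral_of_le ha, integral_rpow (.inl (by linarith [hα.1]))]
        simp [Real.zero_rpow hα.1.ne']

lemma integral_rpowIntegrand_Ioi_le {α : ℝ} (hα : α ∈ Set.Ioo (0 : ℝ) 1) {b x : ℝ}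
    (hb : 0 < b) (hx : x ∈ Set.Icc (0 : ℝ) 1) :
    ∫ t in Set.Ioi b, Real.rpowIntegrand₀₁ α t x ≤ b ^ (α - 1) / (1 - α) := by
  have hα' : α - 2 < -1 := by linarith [hα.2]
  calc ∫ t in Set.Ioi b, Real.rpowIntegrand₀₁ α t x
      ≤ ∫ t in Set.Ioi b, t ^ (α - 2) := by
        refine MeasureTheory.setIntegral_mono_on
          ((Real.integrableOn_rpowIntegrand₀₁_Ioi hα hx.1).mono_set
            (Set.Ioi_subset_Ioi hb.le))
          (integrableOn_Ioi_rpow_of_lt hα' hb) measurableSet_Ioi fun t ht => ?_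
        have ht0 : 0 < t := hb.trans ht
        refine (Real.rpowIntegrand₀₁_le_rpow_sub_two_mul_self hα ht0 hx.1).trans ?_
        exact mul_le_of_le_one_right (by positivity) hx.2
    _ = b ^ (α - 1) / (1 - α) := by
        rw [integral_Ioi_rpow_of_lt hα' hb, show α - 2 + 1 = -(1 - α) by ring, neg_div_neg_eq,
          neg_sub]

open Polynomial in
lemma exists_rational_approx_rpow {α : ℝ} (hα : 0 < α) (hα' : α ≤ 1 / 2) :
    ∃ D : ℝ, 0 < D ∧ ∀ m : ℕ, ∃ P Q : ℝ[X],
      P.natDegree ≤ 2 * m * m ∧ Q.natDegree ≤ 2 * m * m ∧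
      (∀ x ∈ Set.Icc (0 : ℝ) 1, 0 < Q.eval x) ∧
      ∀ x ∈ Set.Icc (0 : ℝ) 1,
        |P.eval x / Q.eval x - x ^ α| ≤ D * Real.exp (-(α * Real.log 2 * m)) := by
  have hα1 : α ∈ Set.Ioo (0 : ℝ) 1 := ⟨hα, by linarith⟩
  have hα2 : 0 < 1 - α := by linarith
  set c := ∫ t in Set.Ioi 0, Real.rpowIntegrand₀₁ α t 1 with hc
  have hc0 : 0 < c := Real.integral_rpowIntegrand₀₁_one_pos hα1
  refine ⟨1 + c⁻¹ * (1 / α + 1 / (1 - α)), by positivity, fun m => ?_⟩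
  have hlog : 0 < Real.log 2 := Real.log_pos (by norm_num)
  set q := Real.exp (-(α * Real.log 2 * m)) with hq
  set a : ℝ := Real.exp (-(Real.log 2 * m)) with ha
  set b : ℝ := Real.exp (Real.log 2 * m) with hb
  have ha0 : 0 < a := Real.exp_pos _
  have hb0 : 0 < b := Real.exp_pos _
  have hab : a ≤ b := Real.exp_le_exp.2 (by linarith [show 0 ≤ Real.log 2 * m by positivity])
  have hb2 : 2 ^ (2 * m) * a = b := by
    have : (2 : ℝ) ^ (2 * m) = Real.exp (Real.log 2 * (2 * m : ℕ)) := by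
      rw [Real.exp_mul, Real.exp_log two_pos, Real.rpow_natCast]
    rw [this, ha, hb, ← Real.exp_add]
    push_cast
    ring_nf
  have haq : a ^ α = q := by
    rw [ha, hq, ← Real.exp_mul]
    ring_nf
  have hbq : b ^ (α - 1) ≤ q := by
    rw [hb, hq, ← Real.exp_mul, Real.exp_le_exp]
    have : 0 ≤ Real.log 2 * m := by positivity
    nlinarith
  have h3q : (1 / 3 : ℝ) ^ m ≤ q := by
    have : (1 / 3 : ℝ) ≤ Real.exp (-(α * Real.log 2)) := by
      calc (1 / 3 : ℝ) ≤ Real.exp (-Real.log 2) := by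
            rw [Real.exp_neg, Real.exp_log two_pos]; norm_num
        _ ≤ _ := Real.exp_le_exp.2 (by nlinarith)
    calc (1 / 3 : ℝ) ^ m ≤ Real.exp (-(α * Real.log 2)) ^ m := by gcongr
      _ = q := by rw [hq, ← Real.exp_nat_mul]; ring_nf
  obtain ⟨A, B, hA, hB, hBpos, hAB⟩ := exists_rational_approx_dyadic_blocks hα1 ha0 m (2 * m)
  refine ⟨C c⁻¹ * A, B, (natDegree_C_mul_le _ _).trans hA, hB, fun x hx => hBpos x hx.1,
    fun x hx => ?_⟩
  have hABx := hAB x hx.1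
  rw [hb2, intervalIntegral.integral_of_le hab] at hABx
  have hint := Real.integrableOn_rpowIntegrand₀₁_Ioi hα1 hx.1
  have hsplit : (∫ t in Set.Ioi 0, Real.rpowIntegrand₀₁ α t x) =
      (∫ t in Set.Ioc 0 a, Real.rpowIntegrand₀₁ α t x) +
        (∫ t in Set.Ioc a b, Real.rpowIntegrand₀₁ α t x) +
        ∫ t in Set.Ioi b, Real.rpowIntegrand₀₁ α t x := by
    rw [add_assoc, ← MeasureTheory.setIntegral_union Set.Ioc_disjoint_Ioi_same measurableSet_Ioi
      (hint.mono_set fun t ht => ha0.trans ht.1) (hint.mono_set fun t ht => hb0.trans ht),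
      Set.Ioc_union_Ioi_eq_Ioi hab,
      ← MeasureTheory.setIntegral_union Set.Ioc_disjoint_Ioi_same measurableSet_Ioi
      (hint.mono_set fun t ht => ht.1) (hint.mono_set fun t ht => ha0.trans ht),
      Set.Ioc_union_Ioi_eq_Ioi ha0.le]
  rw [Real.integral_rpowIntegrand₀₁_eq_rpow_mul_const hα1 hx.1, ← hc] at hsplit
  have h1 := integral_rpowIntegrand_Ioc_zero_le hα1 ha0.le hx.1
  have h2 := integral_rpowIntegrand_Ioi_le hα1 hb0 hx
  have h1' : 0 ≤ ∫ t in Set.Ioc 0 a, Real.rpowIntegrand₀₁ α t x :=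
    MeasureTheory.setIntegral_nonneg measurableSet_Ioc fun t ht =>
      Real.rpowIntegrand₀₁_nonneg hα ht.1.le hx.1
  have h2' : 0 ≤ ∫ t in Set.Ioi b, Real.rpowIntegrand₀₁ α t x :=
    MeasureTheory.setIntegral_nonneg measurableSet_Ioi fun t ht =>
      Real.rpowIntegrand₀₁_nonneg hα (hb0.trans ht).le hx.1
  rw [haq] at h1
  have h2q : b ^ (α - 1) / (1 - α) ≤ q / (1 - α) := by gcongr
  have hxα : x ^ α ≤ 1 := Real.rpow_le_one hx.1 hx.2 hα.le
  have hmid : ∫ t in Set.Ioc a b, Real.rpowIntegrand₀₁ α t x ≤ c := by nlinarith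
  have hmid' : (1 / 3) ^ m * ∫ t in Set.Ioc a b, Real.rpowIntegrand₀₁ α t x ≤ q * c :=
    (mul_le_mul_of_nonneg_left hmid (by positivity)).trans
      (mul_le_mul_of_nonneg_right h3q hc0.le)
  have hfrac : (C c⁻¹ * A).eval x / B.eval x - x ^ α =
      c⁻¹ * (A.eval x / B.eval x - x ^ α * c) := by
    rw [eval_mul, eval_C]
    field_simp
  have hD : (1 + c⁻¹ * (1 / α + 1 / (1 - α))) * q = c⁻¹ * (q * c + q / α + q / (1 - α)) := by
    field_simp
    ring
  rw [hfrac, hD, abs_mul, abs_of_pos (inv_pos.2 hc0)]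
  refine mul_le_mul_of_nonneg_left ?_ (inv_pos.2 hc0).le
  rw [hsplit, abs_le]
  rw [abs_le] at hABx
  have : 0 ≤ q / α := by positivity
  have : 0 ≤ q / (1 - α) := by positivity
  constructor <;> linarith [hABx.1, hABx.2]

lemma log_ratio_exponent_le_half {p : ℝ} (hp : 2 ≤ p) :
    (Real.log (p / (p - 1)) * Real.log 2) / (Real.log (2 * p / (p - 1)) * Real.log p) ≤ 1 / 2 := by
  have hp1 : 0 < p - 1 := by linarith
  have hr : 1 < p / (p - 1) := by rw [lt_div_iff₀ hp1]; linarith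
  have hr2 : p / (p - 1) ≤ 2 := by rw [div_le_iff₀ hp1]; linarith
  have h0 : 0 < Real.log (p / (p - 1)) := Real.log_pos hr
  have h2 : Real.log (p / (p - 1)) ≤ Real.log 2 := Real.log_le_log (by linarith) hr2
  have hl2 : 0 < Real.log 2 := Real.log_pos (by norm_num)
  have hlp : Real.log 2 ≤ Real.log p := Real.log_le_log two_pos hp
  rw [mul_div_assoc 2, Real.log_mul two_ne_zero (by linarith),
    div_le_iff₀ (mul_pos (add_pos hl2 h0) (hl2.trans_le hlp))]
  nlinarith [mul_le_mul_of_nonneg_left hlp (add_pos hl2 h0).le]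

/-- **Theorem 1 (main theorem).** Let `p ≥ 2` be an integer and let
`c = (log(p/(p-1)) log 2)/(log(2p/(p-1)) log p)`.  There exist `b > 0` and `N > 0`
(depending only on `p`) such that for every integer `n ≥ N` there is a rational function
`P/Q` of type `(n, n-1)`, with `Q > 0` on `[0,1]`, satisfying
`|P(x)/Q(x) - x^(1/p)| ≤ exp(-b n^c)` on `[0,1]`. -/
theorem pth_root_composite_rational_approx (p : ℕ) (hp : 2 ≤ p)
    (c : ℝ)
    (hc : c = (Real.log ((p : ℝ) / ((p : ℝ) - 1)) * Real.log 2) /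
      (Real.log (2 * (p : ℝ) / ((p : ℝ) - 1)) * Real.log p)) :
    ∃ (b : ℝ) (N : ℕ), 0 < b ∧ 0 < N ∧
      ∀ n : ℕ, N ≤ n →
        ∃ P Q : Polynomial ℝ,
          P.natDegree ≤ n ∧ Q.natDegree ≤ n - 1 ∧
          (∀ x ∈ Set.Icc (0 : ℝ) 1, 0 < Q.eval x) ∧
          (∀ x ∈ Set.Icc (0 : ℝ) 1,
            |P.eval x / Q.eval x - x ^ ((1 : ℝ) / p)| ≤
              Real.exp (-(b * (n : ℝ) ^ c))) := by
  have hp2 : (2 : ℝ) ≤ p := by exact_mod_cast hp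
  have hc2 : c ≤ 1 / 2 := hc ▸ log_ratio_exponent_le_half hp2
  have hα : (0 : ℝ) < 1 / p := by positivity
  obtain ⟨D, hD, happrox⟩ := exists_rational_approx_rpow hα
    (one_div_le_one_div_of_le two_pos hp2)
  set β := 1 / (p : ℝ) * Real.log 2 with hβ
  have hβ0 : 0 < β := mul_pos hα (Real.log_pos (by norm_num))
  obtain ⟨M, hM⟩ := Filter.eventually_atTop.1
    ((Real.tendsto_sqrt_atTop.comp tendsto_natCast_atTop_atTop).eventually_ge_atTop
      (4 * (Real.log D + β) / β))
  refine ⟨β / 4, max M 2, by positivity, by positivity, fun n hn => ?_⟩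
  have hn2 : 2 ≤ n := (le_max_right _ _).trans hn
  have hsqrt : 4 * (Real.log D + β) ≤ √n * β :=
    (div_le_iff₀ hβ0).1 (hM n ((le_max_left _ _).trans hn))
  set m := Nat.sqrt n / 2 with hm
  have hdeg : 2 * m * m ≤ n - 1 := by
    have h1 : 2 * m ≤ Nat.sqrt n := by omega
    have h2 : 2 * m * (2 * m) ≤ n := (Nat.mul_le_mul h1 h1).trans (Nat.sqrt_le n)
    have h3 : 2 * m * (2 * m) = 2 * (2 * m * m) := by ring
    omega
  have hmn : √n ≤ 2 * m + 2 := by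
    have h1 : Nat.sqrt n + 1 ≤ 2 * m + 2 := by omega
    have h2 : √n ≤ Nat.sqrt n + 1 := Real.real_sqrt_le_nat_sqrt_succ
    have h3 : ((Nat.sqrt n + 1 : ℕ) : ℝ) ≤ (2 * m + 2 : ℕ) := by exact_mod_cast h1
    push_cast at h3
    linarith
  have hnc : (n : ℝ) ^ c ≤ √n := by
    rw [Real.sqrt_eq_rpow]
    exact Real.rpow_le_rpow_of_exponent_le (by exact_mod_cast (by omega : 1 ≤ n)) hc2
  obtain ⟨P, Q, hP, hQ, hQpos, hPQ⟩ := happrox m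
  refine ⟨P, Q, by omega, by omega, hQpos, fun x hx => (hPQ x hx).trans ?_⟩
  rw [← Real.exp_log hD, ← Real.exp_add, Real.exp_le_exp]
  nlinarith [mul_le_mul_of_nonneg_left hmn hβ0.le, mul_le_mul_of_nonneg_left hnc hβ0.le]
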